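/- Let Ξ ⊆ Ω be a prediction set satisfying Assumption A, with associated set Ξ̄. Then for every function ξ : C[0,T] → (−∞,∞] one has Φ(ξ) = Φ̄(ξ ∘ S̄), where Φ is the superhedging functional on the original space and Φ̄ the superhedging functional on the enlarged space. -/

import Mathlib

open MeasureTheory Filter Set Topology
open scoped ENNReal Classical

noncomputable section

namespace PathwiseSuperhedging

/-- The path space `C[0,T]`: continuous functions on `[0,T]` with the sup-norm. -/
abbrev Path (T : ℝ) := C(Set.Icc (0:ℝ) T, ℝ)

variable (T : ℝ)

instance : MeasurableSpace (Path T) := borel _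
instance : BorelSpace (Path T) := ⟨rfl⟩

variable (hT : 0 ≤ T)

/-- time `0` as an element of `[0,T]`. -/
def t0 : Set.Icc (0:ℝ) T := ⟨0, le_refl 0, hT⟩

/-- clamp a real time into `[0,T]`. -/
def clamp (t : ℝ) : Set.Icc (0:ℝ) T := Set.projIcc 0 T hT t

/-- evaluation of a path at a (clamped) real time. -/
def ev (ω : Path T) (t : ℝ) : ℝ := ω (clamp T hT t)

/-- The stopping times `σ^m_k`:  `σ^m_0 = 0` and
`σ^m_{k+1} = inf { t ≥ σ^m_k : |S_t - S_{σ^m_k}| ≥ 2^{-m} }` (equal to `T+1` if no such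
time `t ≤ T` exists). -/
def sig (m : ℕ) : ℕ → Path T → ℝ
  | 0 => fun _ => 0
  | k + 1 => fun ω =>
      sInf ({t : ℝ | sig m k ω ≤ t ∧ t ≤ T ∧
        (2:ℝ) ^ (-(m:ℤ)) ≤ |ev T hT ω t - ev T hT ω (sig m k ω)|} ∪ {T + 1})

/-- The discretized integral `𝕊^m_t = ∑_k S_{σ^m_k} (S_{σ^m_{k+1} ∧ t} - S_{σ^m_k ∧ t})`. -/
def Sm (m : ℕ) (t : ℝ) (ω : Path T) : ℝ :=
  ∑' k : ℕ, ev T hT ω (sig T hT m k ω) *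
    (ev T hT ω (min (sig T hT m (k + 1) ω) t) - ev T hT ω (min (sig T hT m k ω) t))

/-- The pathwise integral `𝕊_t = liminf_m 𝕊^m_t`. -/
def SS (t : ℝ) (ω : Path T) : ℝ := Filter.liminf (fun m => Sm T hT m t ω) Filter.atTop

/-- The candidate quadratic variation `S_t² - S_0² - 2 𝕊_t`. -/
def qvRaw (ω : Path T) (t : ℝ) : ℝ := (ev T hT ω t) ^ 2 - (ev T hT ω 0) ^ 2 - 2 * SS T hT t ω

/-- The set `Ω` of paths for which `𝕊^m → 𝕊` uniformly and
`t ↦ S_t² - S_0² - 2𝕊_t` is nondecreasing. -/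
def BigOmega : Set (Path T) :=
  {ω | TendstoUniformly (fun m (t : Set.Icc (0:ℝ) T) => Sm T hT m (t : ℝ) ω)
        (fun t => SS T hT (t : ℝ) ω) Filter.atTop ∧
      MonotoneOn (qvRaw T hT ω) (Set.Icc (0:ℝ) T)}

/-- The pathwise quadratic variation `⟨ω⟩`, as an element of `C[0,T]`; it equals
`S² - S_0² - 2𝕊` for `ω ∈ Ω` (this function being continuous there) and `0` otherwise. -/
def qv (ω : Path T) : Path T :=
  if h : ω ∈ BigOmega T hT ∧ Continuous fun t : Set.Icc (0:ℝ) T => qvRaw T hT ω (t : ℝ)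
  then ⟨fun t => qvRaw T hT ω (t : ℝ), h.2⟩ else 0

/-- The raw filtration `F_t = σ(S_s : s ≤ t)` generated by the canonical process. -/
def Fraw (t : ℝ) : MeasurableSpace (Path T) :=
  ⨆ (s : Set.Icc (0:ℝ) T) (_ : (s : ℝ) ≤ t),
    MeasurableSpace.comap (fun ω : Path T => ω s) inferInstance

/-- The right-continuous filtration `F_{t+} = ⋂_{s > t} F_{s ∧ T}`. -/
def Fplus (t : ℝ) : MeasurableSpace (Path T) :=
  ⨅ (s : ℝ) (_ : t < s), Fraw T (min s T)

/-- `τ` is a stopping time for the raw filtration `𝔽`. -/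
def IsStopRaw (τ : Path T → ℝ) : Prop :=
  ∀ t ∈ Set.Icc (0:ℝ) T, MeasurableSet[Fraw T t] {ω | τ ω ≤ t}

/-- `τ` is a stopping time for the right-continuous filtration `𝔽₊`. -/
def IsStopPlus (τ : Path T → ℝ) : Prop :=
  ∀ t ∈ Set.Icc (0:ℝ) T, MeasurableSet[Fplus T t] {ω | τ ω ≤ t}

/-- `f` is measurable with respect to the σ-field `F_{τ+}`. -/
def MeasAtStopPlus (τ f : Path T → ℝ) : Prop :=
  ∀ B : Set ℝ, MeasurableSet B → ∀ t ∈ Set.Icc (0:ℝ) T,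
    MeasurableSet[Fplus T t] (f ⁻¹' B ∩ {ω | τ ω ≤ t})

/-- The set `ℋ` of simple trading strategies `H = ∑_{l=1}^L h_l 1_{(τ_l, τ_{l+1}]}`
with `𝔽₊`-stopping times `0 ≤ τ_1 ≤ ⋯ ≤ τ_{L+1} ≤ T` and bounded `F_{τ_l+}`-measurable
coefficients `h_l`. -/
structure SimpleStrategy where
  L : ℕ
  τ : Fin (L + 1) → Path T → ℝ
  coeff : Fin L → Path T → ℝ
  τ_nonneg : ∀ ω, 0 ≤ τ 0 ω
  τ_mono : ∀ (l : Fin L) (ω), τ l.castSucc ω ≤ τ l.succ ω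
  τ_le : ∀ ω, τ (Fin.last L) ω ≤ T
  τ_stop : ∀ l, IsStopPlus T (τ l)
  coeff_bdd : ∀ l, ∃ C : ℝ, ∀ ω, |coeff l ω| ≤ C
  coeff_meas : ∀ l : Fin L, MeasAtStopPlus T (τ l.castSucc) (coeff l)

/-- The pathwise stochastic integral `(H · X)_t(ω)` of a simple strategy against a process. -/
def integ (H : SimpleStrategy T) (X : ℝ → Path T → ℝ) (t : ℝ) (ω : Path T) : ℝ :=
  ∑ l : Fin H.L, H.coeff l ω *
    (X (min (H.τ l.succ ω) t) ω - X (min (H.τ l.castSucc ω) t) ω)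

/-- The canonical process `S_t(ω) = ω(t)`. -/
def Sproc (t : ℝ) (ω : Path T) : ℝ := ev T hT ω t

/-- `X` is a `Q`-`𝔽`-martingale (on the time interval `[0,T]`). -/
def IsMart (Q : Measure (Path T)) (X : ℝ → Path T → ℝ) : Prop :=
  (∀ t ∈ Set.Icc (0:ℝ) T, Integrable (X t) Q) ∧
  ∀ s t : ℝ, s ∈ Set.Icc (0:ℝ) T → t ∈ Set.Icc (0:ℝ) T → s ≤ t →
    ∀ A : Set (Path T), MeasurableSet[Fraw T s] A →
      ∫ ω in A, X t ω ∂Q = ∫ ω in A, X s ω ∂Q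

/-- `X` is a `Q`-`𝔽`-local martingale: there are `𝔽`-stopping times increasing `Q`-a.s.
to `∞` such that each stopped process is a `Q`-`𝔽`-martingale. -/
def IsLocalMart (Q : Measure (Path T)) (X : ℝ → Path T → ℝ) : Prop :=
  ∃ τ : ℕ → Path T → ℝ,
    (∀ m, IsStopRaw T (τ m)) ∧
    (∀ᵐ ω ∂Q, Monotone (fun m => τ m ω) ∧ Tendsto (fun m => τ m ω) atTop atTop) ∧
    (∀ m, IsMart T Q (fun t ω => X (min (τ m ω) t) ω))

/-- The set `M(Ξ)` of local martingale measures concentrated on `Ξ`. -/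
def MSet (Ξ : Set (Path T)) : Set (Measure (Path T)) :=
  {Q | IsProbabilityMeasure Q ∧ IsLocalMart T Q (Sproc T hT) ∧ Q Ξ = 1}

/-- The set `M_Z(Ξ)` of local martingale measures concentrated on `Ξ` with `E_Q[Z] < ∞`. -/
def MZSet (Ξ : Set (Path T)) (Z : Path T → ℝ≥0∞) : Set (Measure (Path T)) :=
  {Q | IsProbabilityMeasure Q ∧ IsLocalMart T Q (Sproc T hT) ∧ Q Ξ = 1 ∧
       ∫⁻ ω, Z ω ∂Q ≠ ⊤}

/-- The stopped path `ω^t(s) = ω(t ∧ s)`. -/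
def stopPath (ω : Path T) (t : Set.Icc (0:ℝ) T) : Path T :=
  ⟨fun s => ω ⟨min t.1 s.1, le_min t.2.1 s.2.1, (min_le_left _ _).trans t.2.2⟩,
    ω.continuous.comp ((continuous_const.min continuous_subtype_val).subtype_mk _)⟩

/-- Assumption A on the prediction set `Ξ` and its lift `Ξ̄`. -/
structure AssumptionA (Ξ : Set (Path T)) (Xibar : Set (Path T × Path T)) : Prop where
  xi_nonempty : Ξ.Nonempty
  xibar_nonempty : Xibar.Nonempty
  xi_eq : Ξ = {ω ∈ BigOmega T hT | (ω, qv T hT ω) ∈ Xibar}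
  A1 : ∃ K : ℕ → Set (Path T × Path T), (∀ n, IsCompact (K n)) ∧ Xibar = ⋃ n, K n
  A2 : ∀ p ∈ Xibar, p.2 (t0 T hT) = 0 ∧ Monotone p.2
  A3 : ∀ p ∈ Xibar, ∀ t : Set.Icc (0:ℝ) T, (stopPath T p.1 t, stopPath T p.2 t) ∈ Xibar

/-! ### The enlarged space -/

/-- The enlarged space `Ω̄ = C[0,T] × C[0,T]`. -/
abbrev PathPair (T : ℝ) := Path T × Path T

/-- The embedding `ψ(ω) = (ω, ⟨ω⟩)`. -/
def psiMap (ω : Path T) : PathPair T := (ω, qv T hT ω)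

/-- The diagonal set `Δ̄ = ψ(Ω)`. -/
def Delta : Set (PathPair T) := psiMap T hT '' BigOmega T hT

/-- The first canonical process `S̄_t(ω,ν) = ω(t)` on the enlarged space. -/
def SbarProc (t : ℝ) (p : PathPair T) : ℝ := ev T hT p.1 t

/-- The second canonical process `V̄_t(ω,ν) = ν(t)` on the enlarged space. -/
def VbarProc (t : ℝ) (p : PathPair T) : ℝ := ev T hT p.2 t

/-- The process `𝕊̄ = (S̄² - S̄_0² - V̄)/2` on the enlarged space. -/
def SSbarProc (t : ℝ) (p : PathPair T) : ℝ :=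
  ((ev T hT p.1 t) ^ 2 - (ev T hT p.1 0) ^ 2 - ev T hT p.2 t) / 2

/-- The raw filtration `F̄_t = σ(S̄_s, V̄_s : s ≤ t)` on the enlarged space. -/
def FbarRaw (t : ℝ) : MeasurableSpace (PathPair T) :=
  ⨆ (s : Set.Icc (0:ℝ) T) (_ : (s : ℝ) ≤ t),
    MeasurableSpace.comap (fun p : PathPair T => (p.1 s, p.2 s)) inferInstance

/-- The right-continuous filtration `F̄_{t+} = ⋂_{s>t} F̄_{s ∧ T}` on the enlarged space. -/
def FbarPlus (t : ℝ) : MeasurableSpace (PathPair T) :=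
  ⨅ (s : ℝ) (_ : t < s), FbarRaw T (min s T)

/-- The σ-field generated by all subsets of `Δ̄ᶜ`. -/
def nullDelta : MeasurableSpace (PathPair T) :=
  MeasurableSpace.generateFrom {N : Set (PathPair T) | N ⊆ (Delta T hT)ᶜ}

/-- The `Δ̄`-augmented raw filtration `F̄^Δ_t`. -/
def FbarDelta (t : ℝ) : MeasurableSpace (PathPair T) := FbarRaw T t ⊔ nullDelta T hT

/-- The `Δ̄`-augmented right-continuous filtration `F̄^Δ_{t+}`. -/
def FbarDeltaPlus (t : ℝ) : MeasurableSpace (PathPair T) := FbarPlus T t ⊔ nullDelta T hT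

/-- `τ` is a stopping time for the raw filtration `𝔽̄` on the enlarged space. -/
def IsStopBarRaw (τ : PathPair T → ℝ) : Prop :=
  ∀ t ∈ Set.Icc (0:ℝ) T, MeasurableSet[FbarRaw T t] {p | τ p ≤ t}

/-- `τ` is a stopping time for the filtration `𝔽̄₊^Δ`. -/
def IsStopBarDeltaPlus (τ : PathPair T → ℝ) : Prop :=
  ∀ t ∈ Set.Icc (0:ℝ) T, MeasurableSet[FbarDeltaPlus T hT t] {p | τ p ≤ t}

/-- `f` is measurable with respect to `F̄^Δ_{τ+}`. -/
def MeasAtStopBarDeltaPlus (τ f : PathPair T → ℝ) : Prop :=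
  ∀ B : Set ℝ, MeasurableSet B → ∀ t ∈ Set.Icc (0:ℝ) T,
    MeasurableSet[FbarDeltaPlus T hT t] (f ⁻¹' B ∩ {p | τ p ≤ t})

/-- The set `ℋ̄` of simple strategies on the enlarged space. -/
structure SimpleStrategyBar where
  L : ℕ
  τ : Fin (L + 1) → PathPair T → ℝ
  coeff : Fin L → PathPair T → ℝ
  τ_nonneg : ∀ p, 0 ≤ τ 0 p
  τ_mono : ∀ (l : Fin L) (p), τ l.castSucc p ≤ τ l.succ p
  τ_le : ∀ p, τ (Fin.last L) p ≤ T
  τ_stop : ∀ l, IsStopBarDeltaPlus T hT (τ l)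
  coeff_bdd : ∀ l, ∃ C : ℝ, ∀ p, |coeff l p| ≤ C
  coeff_meas : ∀ l : Fin L, MeasAtStopBarDeltaPlus T hT (τ l.castSucc) (coeff l)

/-- The pathwise stochastic integral on the enlarged space. -/
def integBar (H : SimpleStrategyBar T hT) (X : ℝ → PathPair T → ℝ) (t : ℝ)
    (p : PathPair T) : ℝ :=
  ∑ l : Fin H.L, H.coeff l p *
    (X (min (H.τ l.succ p) t) p - X (min (H.τ l.castSucc p) t) p)

/-- `X` is a `Q̄`-`𝔽̄`-martingale on the enlarged space. -/
def IsMartBar (Q : Measure (PathPair T)) (X : ℝ → PathPair T → ℝ) : Prop :=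
  (∀ t ∈ Set.Icc (0:ℝ) T, Integrable (X t) Q) ∧
  ∀ s t : ℝ, s ∈ Set.Icc (0:ℝ) T → t ∈ Set.Icc (0:ℝ) T → s ≤ t →
    ∀ A : Set (PathPair T), MeasurableSet[FbarRaw T s] A →
      ∫ p in A, X t p ∂Q = ∫ p in A, X s p ∂Q

/-- `X` is a `Q̄`-`𝔽̄`-local martingale on the enlarged space. -/
def IsLocalMartBar (Q : Measure (PathPair T)) (X : ℝ → PathPair T → ℝ) : Prop :=
  ∃ τ : ℕ → PathPair T → ℝ,
    (∀ m, IsStopBarRaw T (τ m)) ∧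
    (∀ᵐ p ∂Q, Monotone (fun m => τ m p) ∧ Tendsto (fun m => τ m p) atTop atTop) ∧
    (∀ m, IsMartBar T Q (fun t p => X (min (τ m p) t) p))

/-- The set `M̄(Ξ̄)` of measures on the enlarged space under which `S̄` and `𝕊̄` are local
martingales and which are concentrated on `Ξ̄`. -/
def MbarSet (Xibar : Set (PathPair T)) : Set (Measure (PathPair T)) :=
  {Q | IsProbabilityMeasure Q ∧ IsLocalMartBar T Q (SbarProc T hT) ∧
       IsLocalMartBar T Q (SSbarProc T hT) ∧ Q Xibar = 1}

/-- The set `M̄_{Z̄}(Ξ̄)`. -/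
def MbarZSet (Xibar : Set (PathPair T)) (Zbar : PathPair T → ℝ≥0∞) :
    Set (Measure (PathPair T)) :=
  {Q | IsProbabilityMeasure Q ∧ IsLocalMartBar T Q (SbarProc T hT) ∧
       IsLocalMartBar T Q (SSbarProc T hT) ∧ Q Xibar = 1 ∧ ∫⁻ p, Zbar p ∂Q ≠ ⊤}

/-! ### Expectations and superhedging functionals -/

/-- The positive part of an extended real number, as an element of `[0,∞]`. -/
def erealPos (x : EReal) : ℝ≥0∞ := if x = ⊤ then ⊤ else ENNReal.ofReal x.toReal

/-- The expectation `E_Q[ξ]` of an extended-real-valued random variable, as an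
extended real number (positive part minus negative part). -/
def expEReal {α : Type*} [MeasurableSpace α] (Q : Measure α) (ξ : α → EReal) : EReal :=
  ((∫⁻ x, erealPos (ξ x) ∂Q : ℝ≥0∞) : EReal) - ((∫⁻ x, erealPos (-ξ x) ∂Q : ℝ≥0∞) : EReal)

/-- The set of initial capitals `λ` that allow superhedging `ξ` on `Ξ`
(trading in `S` and `𝕊` with simple strategies, in the liminf sense). -/
def PhiSet (Ξ : Set (Path T)) (ξ : Path T → EReal) : Set ℝ :=
  {lam : ℝ | ∃ H G : ℕ → SimpleStrategy T,
    (∀ n : ℕ, ∀ t ∈ Set.Icc (0:ℝ) T, ∀ ω ∈ Ξ,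
      0 ≤ lam + integ T (H n) (Sproc T hT) t ω + integ T (G n) (SS T hT) t ω) ∧
    (∀ ω ∈ Ξ, ξ ω ≤ (lam : EReal) +
      Filter.liminf (fun n =>
        ((integ T (H n) (Sproc T hT) T ω + integ T (G n) (SS T hT) T ω : ℝ) : EReal))
        Filter.atTop)}

/-- The superhedging price `Φ(ξ)`. -/
def Phi (Ξ : Set (Path T)) (ξ : Path T → EReal) : EReal :=
  sInf ((fun lam : ℝ => (lam : EReal)) '' PhiSet T hT Ξ ξ)

/-- The supremum of the pricing functionals `E_Q[ξ]` over `Q ∈ M(Ξ)`,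
for a nonnegative claim `ξ`. -/
def supMart (Ξ : Set (Path T)) (ξ : Path T → ℝ≥0∞) : ℝ≥0∞ :=
  ⨆ Q ∈ MSet T hT Ξ, ∫⁻ ω, ξ ω ∂Q

/-- The liminf-closure `𝒢^Ξ_λ`: the smallest set of functions `C[0,T] → [-∞,∞]`
containing `λ + (H·S)_T` for admissible simple `H` and closed under countable liminf. -/
inductive GG (Ξ : Set (Path T)) (lam : ℝ) : (Path T → EReal) → Prop
  | base (H : SimpleStrategy T)
      (hadm : ∀ t ∈ Set.Icc (0:ℝ) T, ∀ ω ∈ Ξ, 0 ≤ lam + integ T H (Sproc T hT) t ω) :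
      GG Ξ lam (fun ω => ((lam + integ T H (Sproc T hT) T ω : ℝ) : EReal))
  | lim (X : ℕ → Path T → EReal) (h : ∀ n, GG Ξ lam (X n)) :
      GG Ξ lam (fun ω => Filter.liminf (fun n => X n ω) Filter.atTop)

/-- The superhedging price `Φ^cl(ξ)` defined via the liminf-closure. -/
def PhiCl (Ξ : Set (Path T)) (ξ : Path T → EReal) : EReal :=
  sInf {x : EReal | ∃ lam : ℝ, x = (lam : EReal) ∧
    ∃ Y : Path T → EReal, GG T hT Ξ lam Y ∧ ∀ ω ∈ Ξ, ξ ω ≤ Y ω}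


/-- The set of initial capitals allowing superhedging on the enlarged space
(superhedging on `Δ̄ ∩ Ξ̄`). -/
def PhiBarSet (Xibar : Set (PathPair T)) (ξ : PathPair T → EReal) : Set ℝ :=
  {lam : ℝ | ∃ H G : ℕ → SimpleStrategyBar T hT,
    (∀ n : ℕ, ∀ t ∈ Set.Icc (0:ℝ) T, ∀ p ∈ Delta T hT ∩ Xibar,
      0 ≤ lam + integBar T hT (H n) (SbarProc T hT) t p
            + integBar T hT (G n) (SSbarProc T hT) t p) ∧
    (∀ p ∈ Delta T hT ∩ Xibar, ξ p ≤ (lam : EReal) +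
      Filter.liminf (fun n =>
        ((integBar T hT (H n) (SbarProc T hT) T p
          + integBar T hT (G n) (SSbarProc T hT) T p : ℝ) : EReal)) Filter.atTop)}

/-- The superhedging price `Φ̄(ξ̄)` on the enlarged space. -/
def PhiBar (Xibar : Set (PathPair T)) (ξ : PathPair T → EReal) : EReal :=
  sInf ((fun lam : ℝ => (lam : EReal)) '' PhiBarSet T hT Xibar ξ)

/-- The supremum of pricing functionals over `M̄(Ξ̄)` for a nonnegative claim. -/
def supMartBar (Xibar : Set (PathPair T)) (ξ : PathPair T → ℝ≥0∞) : ℝ≥0∞ :=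
  ⨆ Q ∈ MbarSet T hT Xibar, ∫⁻ p, ξ p ∂Q

/-- Assumption B on the prediction set `Ξ`, determined by a growth function `Z̄`
(with values in `[1,∞]`). -/
structure AssumptionB (Ξ : Set (Path T)) (Zbar : PathPair T → ℝ≥0∞) : Prop where
  xi_nonempty : Ξ.Nonempty
  one_le : ∀ p, 1 ≤ Zbar p
  xi_eq : Ξ = {ω ∈ BigOmega T hT | Zbar (ω, qv T hT ω) ≠ ⊤}
  B1 : ∀ c : ℝ≥0∞, c ≠ ⊤ → IsCompact {p : PathPair T | Zbar p ≤ c}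
  B2 : ∀ p : PathPair T, Zbar p ≠ ⊤ → p.2 (t0 T hT) = 0 ∧ Monotone p.2
  B3 : ∀ p : PathPair T, ENNReal.ofReal (‖p.1‖ + ‖p.2‖) ≤ Zbar p

/-- The set of initial capitals allowing `Z`-admissible superhedging of `ξ` on `Ξ`. -/
def PhiZSet (Ξ : Set (Path T)) (Z : Path T → ℝ≥0∞) (ξ : Path T → EReal) : Set ℝ :=
  {lam : ℝ | ∃ c : ℝ, 0 ≤ c ∧ ∃ H G : ℕ → SimpleStrategy T,
    (∀ n : ℕ, ∀ ω ∈ Ξ,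
      -(c * (Z ω).toReal) ≤
        lam + integ T (H n) (Sproc T hT) T ω + integ T (G n) (SS T hT) T ω) ∧
    (∀ ω ∈ Ξ, ξ ω ≤ (lam : EReal) +
      Filter.liminf (fun n =>
        ((integ T (H n) (Sproc T hT) T ω + integ T (G n) (SS T hT) T ω : ℝ) : EReal))
        Filter.atTop)}

/-- The superhedging price `Φ^Z(ξ)`. -/
def PhiZ (Ξ : Set (Path T)) (Z : Path T → ℝ≥0∞) (ξ : Path T → EReal) : EReal :=
  sInf ((fun lam : ℝ => (lam : EReal)) '' PhiZSet T hT Ξ Z ξ)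

/-- The `α`-Hölder norm `‖ω‖_α = |ω(0)| + sup_{s ≠ t} |ω(t) - ω(s)| / |t-s|^α`,
with values in `[0,∞]`. -/
def holderNormE (α : ℝ) (ω : Path T) : ℝ≥0∞ :=
  ENNReal.ofReal |ω (t0 T hT)| +
    ⨆ (s : Set.Icc (0:ℝ) T) (t : Set.Icc (0:ℝ) T) (_ : s ≠ t),
      ENNReal.ofReal (|ω t - ω s| / |t.1 - s.1| ^ α)

/-- The set of Hölder continuous paths `⋃_n { ω : ‖ω‖_{1/n} ≤ n }`. -/
def CHolder : Set (Path T) :=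
  ⋃ n : ℕ, {ω : Path T | 0 < n ∧ holderNormE T hT (1 / n) ω ≤ (n : ℝ≥0∞)}

end PathwiseSuperhedging

namespace PathwiseSuperhedging

section Ext

variable {X : Type*} {F : ℝ → MeasurableSpace X} {O : Set X}

lemma meas_liminf {m : MeasurableSpace X} {f : ℕ → X → ℝ} (hf : ∀ n, Measurable (f n)) :
    Measurable fun x => liminf (fun n => f n x) atTop := Measurable.liminf hf

lemma meas_idx {m : MeasurableSpace X} {g : ℕ → X → ℝ} (hg : ∀ n, Measurable (g n))
    {k : X → ℕ} (hk : Measurable k) : Measurable fun x => g (k x) x := by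
  have hm : Measurable fun p : X × ℕ => g p.2 p.1 :=
    measurable_from_prod_countable_left fun n => hg n
  exact hm.comp (measurable_id.prodMk hk)

lemma meas_ind {m : MeasurableSpace X} {E : Set X} (hE : MeasurableSet E) :
    Measurable (E.indicator fun _ => (1:ℝ)) := measurable_const.indicator hE

lemma ext_fun (hF : Monotone F) (t : ℝ) (f : O → ℝ)
    (hf : ∀ s, t < s → Measurable[MeasurableSpace.comap Subtype.val (F s)] f) :
    ∃ g : X → ℝ, (∀ s, t < s → Measurable[F s] g) ∧ ∀ x : O, g x = f x := by
  have h1 : ∀ n : ℕ, ∃ g : X → ℝ, Measurable[F (t + 1 / ((n:ℝ) + 1))] g ∧ f = g ∘ Subtype.val := by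
    intro n
    have hp : (0:ℝ) < 1 / ((n:ℝ) + 1) := by positivity
    exact @Measurable.exists_eq_measurable_comp _ _ _ (F (t + 1 / ((n:ℝ) + 1))) _ _ _ _ _
      (hf (t + 1 / ((n:ℝ) + 1)) (by linarith))
  choose g hg hgf using h1
  refine ⟨fun x => liminf (fun n => g n x) atTop, ?_, ?_⟩
  · intro s hs
    obtain ⟨N, hN⟩ := exists_nat_one_div_lt (sub_pos.2 hs)
    have h2 : (fun x => liminf (fun n => g n x) atTop) =
        fun x => liminf (fun n => g (n + N) x) atTop := by
      funext x
      exact (Filter.liminf_nat_add (fun n => g n x) N).symm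
    rw [h2]
    refine meas_liminf (m := F s) (fun n => ?_)
    refine (hg (n + N)).mono (hF ?_) le_rfl
    have : 1 / (((n + N : ℕ) : ℝ) + 1) ≤ 1 / ((N:ℝ) + 1) := by
      apply one_div_le_one_div_of_le (by positivity)
      push_cast
      have : (0:ℝ) ≤ n := by positivity
      linarith
    linarith
  · intro x
    have : (fun n => g n (x : X)) = fun _ => f x := by
      funext n
      rw [hgf n]; rfl
    simp only [this]
    exact liminf_const _

lemma ext_set (hF : Monotone F) (t : ℝ) (E : Set O)
    (hE : ∀ s, t < s → MeasurableSet[MeasurableSpace.comap Subtype.val (F s)] E) :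
    ∃ B : Set X, (∀ s, t < s → MeasurableSet[F s] B) ∧ ∀ x : O, (x : X) ∈ B ↔ x ∈ E := by
  obtain ⟨g, hg, hgE⟩ := ext_fun hF t (E.indicator fun _ => (1:ℝ))
    (fun s hs => meas_ind (m := MeasurableSpace.comap Subtype.val (F s)) (hE s hs))
  refine ⟨g ⁻¹' {1}, fun s hs => hg s hs (measurableSet_singleton _), fun x => ?_⟩
  simp only [mem_preimage, mem_singleton_iff, hgE]
  by_cases hx : x ∈ E <;> simp [hx]

lemma ext_stop (hF : Monotone F) {T : ℝ} (hT : 0 ≤ T) (τ : O → ℝ) (h0 : ∀ x, 0 ≤ τ x)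
    (h1 : ∀ x, τ x ≤ T)
    (hτ : ∀ t ∈ Icc 0 T, ∀ s, t < s →
      MeasurableSet[MeasurableSpace.comap Subtype.val (F s)] {x | τ x ≤ t}) :
    ∃ τ' : X → ℝ, (∀ x, 0 ≤ τ' x) ∧ (∀ x, τ' x ≤ T) ∧
      (∀ t ∈ Icc 0 T, ∀ s, t < s → MeasurableSet[F s] {x | τ' x ≤ t}) ∧
      ∀ x : O, τ' x = τ x := by
  have hA : ∀ t : ℝ, ∃ B : Set X, t ∈ Icc 0 T →
      (∀ s, t < s → MeasurableSet[F s] B) ∧ ∀ x : O, (x : X) ∈ B ↔ τ x ≤ t := by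
    intro t
    by_cases ht : t ∈ Icc 0 T
    · obtain ⟨B, hB, hB'⟩ := ext_set hF t {x | τ x ≤ t} (hτ t ht)
      exact ⟨B, fun _ => ⟨hB, hB'⟩⟩
    · exact ⟨∅, fun h => absurd h ht⟩
  choose A hA using hA
  let D : X → Set ℝ := fun x => insert T {t | t ∈ Icc 0 T ∧ (∃ q : ℚ, t = q) ∧ x ∈ A t}
  have hD0 : ∀ x, ∀ t ∈ D x, 0 ≤ t := by
    rintro x t (rfl | ht)
    · exact hT
    · exact ht.1.1
  have hbdd : ∀ x, BddBelow (D x) := fun x => ⟨0, fun t ht => hD0 x t ht⟩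
  have hne : ∀ x, (D x).Nonempty := fun x => ⟨T, mem_insert _ _⟩
  refine ⟨fun x => sInf (D x), fun x => le_csInf (hne x) (hD0 x),
    fun x => csInf_le (hbdd x) (mem_insert _ _), ?_, ?_⟩
  · intro t ht s hs
    rcases eq_or_lt_of_le ht.2 with rfl | htT
    · have : {x | sInf (D x) ≤ t} = univ :=
        eq_univ_of_forall fun x => csInf_le (hbdd x) (mem_insert _ _)
      rw [this]; exact @MeasurableSet.univ _ (F s)
    · have : {x | sInf (D x) ≤ t} = ⋂ (r : ℚ) (_ : t < r ∧ (r:ℝ) < min s T),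
          ⋃ (q : ℚ) (_ : (q:ℝ) ∈ Icc 0 T ∧ (q:ℝ) < r), A q := by
        ext x
        simp only [mem_ofPred_eq, mem_iInter, mem_iUnion]
        constructor
        · intro hx r hr
          obtain ⟨u, hu, hur⟩ := exists_lt_of_csInf_lt (hne x) (lt_of_le_of_lt hx hr.1)
          rcases hu with rfl | ⟨hu1, ⟨q, rfl⟩, hu2⟩
          · exact absurd (hr.2.trans_le (min_le_right _ _)) (not_lt.2 hur.le)
          · exact ⟨q, ⟨hu1, hur⟩, hu2⟩
        · intro hx
          by_contra hcon
          push Not at hcon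
          obtain ⟨r, hr1, hr2⟩ := exists_rat_btwn (lt_min hcon (lt_min hs htT))
          obtain ⟨q, ⟨hq1, hq2⟩, hq3⟩ := hx r ⟨hr1, hr2.trans_le (min_le_right _ _)⟩
          have : sInf (D x) ≤ q := csInf_le (hbdd x) (Or.inr ⟨hq1, ⟨q, rfl⟩, hq3⟩)
          have := hr2.trans_le (min_le_left _ _)
          linarith
      rw [this]
      refine @MeasurableSet.iInter _ _ (F s) _ _ fun r => @MeasurableSet.iInter _ _ (F s) _ _ fun hr => ?_
      refine @MeasurableSet.iUnion _ _ (F s) _ _ fun q => @MeasurableSet.iUnion _ _ (F s) _ _ fun hq => ?_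
      exact (hA q hq.1).1 s (hq.2.trans (hr.2.trans_le (min_le_left _ _)))
  · intro x
    apply le_antisymm
    · by_contra hcon
      push Not at hcon
      obtain ⟨r, hr1, hr2⟩ := exists_rat_btwn hcon
      have hrT : (r:ℝ) ≤ T := hr2.le.trans (csInf_le (hbdd x) (mem_insert _ _))
      have hr : (r:ℝ) ∈ Icc 0 T := ⟨(h0 x).trans hr1.le, hrT⟩
      have : sInf (D x) ≤ r :=
        csInf_le (hbdd x) (Or.inr ⟨hr, ⟨r, rfl⟩, ((hA r hr).2 x).2 hr1.le⟩)
      linarith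
    · apply le_csInf (hne x)
      rintro u (rfl | ⟨hu1, -, hu2⟩)
      · exact h1 x
      · exact ((hA u hu1).2 x).1 hu2

lemma ext_coeff (hF : Monotone F) {T : ℝ} (hT : 0 ≤ T) (τ : O → ℝ) (τ' : X → ℝ)
    (h0 : ∀ x, 0 ≤ τ' x) (h1 : ∀ x, τ' x ≤ T)
    (hτ' : ∀ t ∈ Icc 0 T, ∀ s, t < s → MeasurableSet[F s] {x | τ' x ≤ t})
    (hag : ∀ x : O, τ' x = τ x) (h : O → ℝ) (C : ℝ) (hC : ∀ x, |h x| ≤ C)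
    (hh : ∀ B : Set ℝ, MeasurableSet B → ∀ t ∈ Icc 0 T, ∀ s, t < s →
      MeasurableSet[MeasurableSpace.comap Subtype.val (F s)] (h ⁻¹' B ∩ {x | τ x ≤ t})) :
    ∃ h' : X → ℝ, (∃ C, ∀ x, |h' x| ≤ C) ∧
      (∀ B : Set ℝ, MeasurableSet B → ∀ t ∈ Icc 0 T, ∀ s, t < s →
        MeasurableSet[F s] (h' ⁻¹' B ∩ {x | τ' x ≤ t})) ∧ ∀ x : O, h' x = h x := by
  have hG : ∀ q : ℝ, ∃ g : X → ℝ, q ∈ Icc 0 T → (∀ s, q < s → Measurable[F s] g) ∧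
      ∀ x : O, τ x ≤ q → g x = h x := by
    intro q
    by_cases hq : q ∈ Icc 0 T
    · obtain ⟨g, hg, hgf⟩ := ext_fun hF q (indicator {x | τ x ≤ q} h) (by
        intro s hs
        intro B hB
        have hset : MeasurableSet[MeasurableSpace.comap Subtype.val (F s)] {x : O | τ x ≤ q} := by
          simpa using hh univ MeasurableSet.univ q hq s hs
        have e : (indicator {x : O | τ x ≤ q} h) ⁻¹' B =
            (h ⁻¹' B ∩ {x | τ x ≤ q}) ∪ ({x | τ x ≤ q}ᶜ ∩ {x | (0:ℝ) ∈ B}) := by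
          ext x
          by_cases hx : τ x ≤ q <;> simp [indicator, hx]
        rw [e]
        exact @MeasurableSet.union _ (MeasurableSpace.comap Subtype.val (F s)) _ _
          (hh B hB q hq s hs)
          (@MeasurableSet.inter _ (MeasurableSpace.comap Subtype.val (F s)) _ _
            (@MeasurableSet.compl _ _ (MeasurableSpace.comap Subtype.val (F s)) hset)
            (@MeasurableSet.const _ (MeasurableSpace.comap Subtype.val (F s)) _)))
      refine ⟨g, fun _ => ⟨hg, fun x hx => ?_⟩⟩
      rw [hgf, indicator_of_mem]
      exact hx
    · exact ⟨0, fun h => absurd h hq⟩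
  choose g hg using hG
  let d : ℕ → ℝ → ℝ := fun n y => min T (((⌊y * (n+1)⌋₊ : ℝ) + 1) / (n + 1))
  have hd : ∀ n y, 0 ≤ y → y ≤ T → y ≤ d n y ∧ d n y ≤ y + 1 / (n + 1) ∧ d n y ∈ Icc 0 T := by
    intro n y hy hyT
    have hn : (0:ℝ) < n + 1 := by positivity
    have e1 : y ≤ (((⌊y * (n+1)⌋₊ : ℝ) + 1) / (n + 1)) := by
      rw [le_div_iff₀ hn]; exact (Nat.lt_floor_add_one _).le
    have e2 : (((⌊y * (n+1)⌋₊ : ℝ) + 1) / (n + 1)) ≤ y + 1 / (n + 1) := by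
      rw [add_div]
      gcongr
      rw [div_le_iff₀ hn]; exact Nat.floor_le (by positivity)
    exact ⟨le_min hyT e1, (min_le_right _ _).trans e2, le_min hT (hy.trans e1), min_le_left _ _⟩
  refine ⟨fun x => max (-C) (min C (liminf (fun n => g (d n (τ' x)) x) atTop)), ⟨|C|, ?_⟩, ?_, ?_⟩
  · intro x
    rw [abs_le]
    constructor
    · exact (neg_le_neg (le_abs_self C)).trans (le_max_left _ _)
    · exact max_le (neg_le_abs C) ((min_le_left _ _).trans (le_abs_self C))
  · intro B hB t ht s hs
    obtain ⟨s', hs1, hs2⟩ := exists_between hs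
    obtain ⟨N, hN⟩ := exists_nat_one_div_lt (sub_pos.2 hs1)
    let _ : MeasurableSpace X := F s
    have hmin : Measurable (fun x => min (τ' x) t) := by
      refine measurable_of_Iic fun c => ?_
      by_cases hc : t ≤ c
      · convert MeasurableSet.univ
        ext x; simp [hc]
      · push Not at hc
        by_cases hc0 : 0 ≤ c
        · convert hτ' c ⟨hc0, hc.le.trans ht.2⟩ s (hc.trans hs) using 1
          ext x; simp [hc]
        · convert MeasurableSet.empty
          ext x
          simp only [mem_preimage, mem_Iic, min_le_iff, mem_empty_iff_false, iff_false, not_or]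
          exact ⟨by linarith [h0 x], by linarith⟩
    have hk : ∀ n : ℕ, Measurable fun x => g (min s' (d n (min (τ' x) t))) x := by
      intro n
      have hk0 : Measurable fun x => ⌊min (τ' x) t * ((n:ℝ) + 1)⌋₊ :=
        Nat.measurable_floor.comp (hmin.mul_const ((n:ℝ)+1))
      refine meas_idx (g := fun k => g (min s' (min T (((k : ℝ) + 1) / (n + 1))))) ?_ hk0
      intro k
      refine (hg _ ⟨le_min (ht.1.trans hs1.le) (le_min hT (by positivity)),
          (min_le_right _ _).trans (min_le_left _ _)⟩).1 s ?_
      exact (min_le_left _ _).trans_lt hs2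
    have hmeas : Measurable fun x => max (-C) (min C
        (liminf (fun n => g (min s' (d (n + N) (min (τ' x) t))) x) atTop)) :=
      measurable_const.max (measurable_const.min (meas_liminf fun n => hk (n + N)))
    have e : (fun x => max (-C) (min C (liminf (fun n => g (d n (τ' x)) x) atTop))) ⁻¹' B
        ∩ {x | τ' x ≤ t} = (fun x => max (-C) (min C
        (liminf (fun n => g (min s' (d (n + N) (min (τ' x) t))) x) atTop))) ⁻¹' B
        ∩ {x | τ' x ≤ t} := by
      ext x
      simp only [mem_inter_iff, mem_preimage, mem_ofPred_eq]
      refine and_congr_left fun hx => ?_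
      rw [← Filter.liminf_nat_add (fun n => g (d n (τ' x)) x) N]
      have : (fun n => g (d (n + N) (τ' x)) x) =
          fun n => g (min s' (d (n + N) (min (τ' x) t))) x := by
        funext n
        rw [min_eq_left hx, min_eq_right]
        refine (hd (n + N) (τ' x) (h0 x) (h1 x)).2.1.trans ?_
        have : 1 / (((n + N : ℕ) : ℝ) + 1) ≤ 1 / ((N:ℝ) + 1) := by
          apply one_div_le_one_div_of_le (by positivity)
          push_cast
          have : (0:ℝ) ≤ n := by positivity
          linarith
        linarith
      rw [this]
    rw [e]
    exact (hmeas hB).inter (hτ' t ht s hs)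
  · intro x
    have : (fun n => g (d n (τ' x)) (x:X)) = fun _ => h x := by
      funext n
      have := hd n (τ' x) (h0 x) (h1 x)
      exact (hg _ this.2.2).2 x (by rw [← hag]; exact this.1)
    simp only [this, liminf_const]
    have := abs_le.1 (hC x)
    rw [min_eq_right this.2, max_eq_right this.1]

end Ext
section Meas

variable {T : ℝ} {hT : 0 ≤ T}

lemma meas_comp_cont {X : Type*} {m : MeasurableSpace X} {u : ℝ → X → ℝ}
    (hc : ∀ x, Continuous fun s => u s x) (hu : ∀ s, Measurable (u s)) {ρ : X → ℝ}
    (hρ : Measurable ρ) : Measurable fun x => u (ρ x) x :=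
  (measurable_uncurry_of_continuous_of_measurable hc hu).comp (hρ.prodMk measurable_id)

lemma meas_pair {X : Type*} {m : MeasurableSpace X} {f g : X → ℝ}
    (hf : Measurable f) (hg : Measurable g) : Measurable fun x => (f x, g x) := hf.prodMk hg

lemma ev_cont (ω : Path T) : Continuous (ev T hT ω) :=
  ω.continuous.comp (continuous_projIcc (h := hT))

lemma sig_succ (m k : ℕ) (ω : Path T) : sig T hT m (k+1) ω =
    sInf ({t : ℝ | sig T hT m k ω ≤ t ∧ t ≤ T ∧
        (2:ℝ) ^ (-(m:ℤ)) ≤ |ev T hT ω t - ev T hT ω (sig T hT m k ω)|} ∪ {T + 1}) := rfl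

lemma sig_le (m k : ℕ) (ω : Path T) : sig T hT m k ω ≤ T + 1 := by
  induction k with
  | zero => simp only [sig]; linarith
  | succ k ih =>
    rw [sig_succ]
    refine csInf_le ⟨sig T hT m k ω, ?_⟩ (Or.inr rfl)
    rintro t (ht | ht)
    · exact ht.1
    · rw [mem_singleton_iff.1 ht]; exact ih

lemma sig_bdd (m k : ℕ) (ω : Path T) : BddBelow ({t : ℝ | sig T hT m k ω ≤ t ∧ t ≤ T ∧
        (2:ℝ) ^ (-(m:ℤ)) ≤ |ev T hT ω t - ev T hT ω (sig T hT m k ω)|} ∪ {T + 1}) := by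
  refine ⟨sig T hT m k ω, ?_⟩
  rintro t (ht | ht)
  · exact ht.1
  · rw [mem_singleton_iff.1 ht]; exact sig_le m k ω

lemma sig_mono (m k : ℕ) (ω : Path T) : sig T hT m k ω ≤ sig T hT m (k+1) ω := by
  rw [sig_succ]
  refine le_csInf ⟨T+1, Or.inr rfl⟩ ?_
  rintro t (ht | ht)
  · exact ht.1
  · rw [mem_singleton_iff.1 ht]; exact sig_le m k ω

lemma sig_nonneg (m k : ℕ) (ω : Path T) : 0 ≤ sig T hT m k ω := by
  induction k with
  | zero => simp [sig]
  | succ k ih => exact ih.trans (sig_mono m k ω)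

lemma sig_le_iff (m k : ℕ) (ω : Path T) {t : ℝ} (ht : t ≤ T) :
    sig T hT m (k+1) ω ≤ t ↔ ∃ s, sig T hT m k ω ≤ s ∧ s ≤ t ∧
      (2:ℝ) ^ (-(m:ℤ)) ≤ |ev T hT ω s - ev T hT ω (sig T hT m k ω)| := by
  constructor
  · intro h
    have hcl : IsClosed ({t : ℝ | sig T hT m k ω ≤ t ∧ t ≤ T ∧
        (2:ℝ) ^ (-(m:ℤ)) ≤ |ev T hT ω t - ev T hT ω (sig T hT m k ω)|} ∪ {T + 1}) := by
      refine IsClosed.union ?_ isClosed_singleton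
      have i3 : IsClosed {t : ℝ | (2:ℝ) ^ (-(m:ℤ)) ≤
          |ev T hT ω t - ev T hT ω (sig T hT m k ω)|} :=
        isClosed_le continuous_const ((ev_cont ω).sub continuous_const).abs
      exact (isClosed_Ici (a := sig T hT m k ω)).inter ((isClosed_Iic (a := T)).inter i3)
    have := hcl.csInf_mem ⟨T+1, Or.inr rfl⟩ (sig_bdd m k ω)
    rw [← sig_succ] at this
    rcases this with h1 | h1
    · exact ⟨_, h1.1, h, h1.2.2⟩
    · rw [mem_singleton_iff.1 h1] at h; linarith
  · rintro ⟨s, h1, h2, h3⟩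
    rw [sig_succ]
    exact (csInf_le (sig_bdd m k ω) (Or.inl ⟨h1, h2.trans ht, h3⟩)).trans h2

lemma sig_eventually (m : ℕ) (ω : Path T) : ∃ N, ∀ k, N ≤ k → sig T hT m k ω = T + 1 := by
  have huc : UniformContinuousOn (ev T hT ω) (Icc 0 (T+1)) :=
    isCompact_Icc.uniformContinuousOn_of_continuous (ev_cont ω).continuousOn
  have heps : (0:ℝ) < (2:ℝ) ^ (-(m:ℤ)) := by positivity
  obtain ⟨δ, hδ, h⟩ := Metric.uniformContinuousOn_iff.1 huc _ heps
  have key : ∀ k : ℕ, min ((k:ℝ) * δ) (T + 1) ≤ sig T hT m k ω := by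
    intro k
    induction k with
    | zero => simp [sig]
    | succ k ih =>
      by_contra hcon
      push Not at hcon
      have hlt := lt_min_iff.1 hcon
      have hT' : sig T hT m (k+1) ω ≤ T := by
        have hcl := sig_le_iff (hT := hT) m k ω (le_refl T)
        by_contra h2
        push Not at h2
        have : T + 1 ≤ sig T hT m (k+1) ω := by
          rw [sig_succ]
          refine le_csInf ⟨T+1, Or.inr rfl⟩ ?_
          rintro t (ht | ht)
          · exact absurd (hcl.2 ⟨t, ht.1, ht.2.1, ht.2.2⟩) (not_le.2 h2)
          · exact (mem_singleton_iff.1 ht).ge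
        linarith [hlt.2]
      obtain ⟨s, h1, h2, h3⟩ := (sig_le_iff (hT := hT) m k ω hT').1 le_rfl
      have hk0 := sig_nonneg (hT := hT) m k ω
      have hkl := sig_le (hT := hT) m k ω
      have hs : δ ≤ |s - sig T hT m k ω| := by
        by_contra h4
        push Not at h4
        have := h s ⟨hk0.trans h1, by linarith⟩ _ ⟨hk0, hkl⟩ (by rwa [Real.dist_eq])
        rw [Real.dist_eq] at this
        linarith
      rw [abs_of_nonneg (by linarith)] at hs
      have hl1 := hlt.1
      push_cast at hl1
      rcases min_le_iff.1 ih with h5 | h5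
      · linarith
      · linarith
  obtain ⟨N, hN⟩ := exists_nat_ge ((T + 1) / δ)
  refine ⟨N, fun k hk => le_antisymm (sig_le m k ω) ?_⟩
  have h1 := key k
  rwa [min_eq_right] at h1
  rw [div_le_iff₀ hδ] at hN
  have : (N:ℝ) ≤ k := by exact_mod_cast hk
  nlinarith

lemma Sm_eq_sum (m : ℕ) (ω : Path T) : ∃ N, ∀ n, N ≤ n → ∀ t ≤ T, Sm T hT m t ω =
    ∑ k ∈ Finset.range n, ev T hT ω (min (sig T hT m k ω) t) *
    (ev T hT ω (min (sig T hT m (k + 1) ω) t) - ev T hT ω (min (sig T hT m k ω) t)) := by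
  obtain ⟨N, hN⟩ := sig_eventually (hT := hT) m ω
  refine ⟨N, fun n hn t ht => ?_⟩
  rw [Sm, tsum_eq_sum (s := Finset.range n)]
  · refine Finset.sum_congr rfl fun k _ => ?_
    rcases le_total (sig T hT m k ω) t with h | h
    · rw [min_eq_left h]
    · rw [min_eq_right h, min_eq_right (h.trans (sig_mono m k ω))]; simp
  · intro k hk
    have hk : n ≤ k := by simpa using hk
    rw [hN k (hn.trans hk), hN (k+1) (by omega)]; simp

lemma Sm_cont (m : ℕ) (ω : Path T) :
    Continuous fun t : Icc (0:ℝ) T => Sm T hT m (t : ℝ) ω := by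
  obtain ⟨N, hN⟩ := Sm_eq_sum (hT := hT) m ω
  have : (fun t : Icc (0:ℝ) T => Sm T hT m (t : ℝ) ω) = fun t : Icc (0:ℝ) T =>
      ∑ k ∈ Finset.range N, ev T hT ω (min (sig T hT m k ω) t) *
    (ev T hT ω (min (sig T hT m (k + 1) ω) t) - ev T hT ω (min (sig T hT m k ω) t)) := by
    funext t; exact hN N le_rfl t t.2.2
  rw [this]
  refine continuous_finsetSum _ fun k _ => ?_
  have hc : ∀ c : ℝ, Continuous fun t : Icc (0:ℝ) T => ev T hT ω (min c t) := fun c =>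
    (ev_cont ω).comp (continuous_const.min continuous_subtype_val)
  exact (hc _).mul ((hc _).sub (hc _))

lemma qvRaw_cont {ω : Path T} (hω : ω ∈ BigOmega T hT) :
    Continuous fun t : Icc (0:ℝ) T => qvRaw T hT ω (t : ℝ) := by
  have h1 : Continuous fun t : Icc (0:ℝ) T => SS T hT (t : ℝ) ω :=
    hω.1.continuous (Eventually.of_forall fun m => Sm_cont m ω).frequently
  have h2 : Continuous fun t : Icc (0:ℝ) T => ev T hT ω t :=
    (ev_cont ω).comp continuous_subtype_val
  exact ((h2.pow 2).sub continuous_const).sub (continuous_const.mul h1)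

lemma qv_apply {ω : Path T} (hω : ω ∈ BigOmega T hT) (t : Icc (0:ℝ) T) :
    qv T hT ω t = qvRaw T hT ω t := by
  rw [qv, dif_pos ⟨hω, qvRaw_cont hω⟩]; rfl

lemma ev_qv {ω : Path T} (hω : ω ∈ BigOmega T hT) {t : ℝ} (ht : t ∈ Icc 0 T) :
    ev T hT (qv T hT ω) t = qvRaw T hT ω t := by
  rw [ev, qv_apply hω, clamp, projIcc_of_mem hT ht]

lemma SSbar_psi {ω : Path T} (hω : ω ∈ BigOmega T hT) {t : ℝ} (ht : t ∈ Icc 0 T) :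
    SSbarProc T hT t (psiMap T hT ω) = SS T hT t ω := by
  simp only [SSbarProc, psiMap]
  rw [ev_qv hω ht, qvRaw]; ring

lemma Fraw_mono : Monotone (Fraw T) := by
  intro s t hst
  exact iSup_mono fun u => iSup_le fun hu => le_iSup_of_le (hu.trans hst) le_rfl

lemma eval_meas {s : Icc (0:ℝ) T} {t : ℝ} (h : (s:ℝ) ≤ t) :
    Measurable[Fraw T t] fun ω : Path T => ω s := by
  rw [measurable_iff_comap_le]
  exact le_iSup_of_le s (le_iSup_of_le h le_rfl)

lemma ev_meas {s t : ℝ} (ht : 0 ≤ t) (h : s ≤ t) :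
    Measurable[Fraw T t] fun ω : Path T => ev T hT ω s := by
  refine eval_meas ?_
  simp only [clamp, coe_projIcc]
  exact max_le ht ((min_le_right _ _).trans h)

lemma ev_comp_meas {t : ℝ} (ht : 0 ≤ t) {ρ : Path T → ℝ} (hρ : Measurable[Fraw T t] ρ)
    (hρt : ∀ ω, ρ ω ≤ t) : Measurable[Fraw T t] fun ω : Path T => ev T hT ω (ρ ω) := by
  have h := meas_comp_cont (m := Fraw T t) (u := fun s ω => ev T hT ω (min s t))
    (fun ω => (ev_cont ω).comp (continuous_id.min continuous_const))
    (fun s => ev_meas ht (min_le_right _ _)) hρ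
  convert h using 2 with ω
  simp [min_eq_left (hρt ω)]

lemma min_meas {X : Type*} {F : ℝ → MeasurableSpace X} (hF : Monotone F) {T t : ℝ}
    (ht : t ∈ Icc 0 T) {σ : X → ℝ} (h0 : ∀ x, 0 ≤ σ x)
    (hσ : ∀ c ∈ Icc 0 T, MeasurableSet[F c] {x | σ x ≤ c}) :
    Measurable[F t] fun x => min (σ x) t := by
  let _ : MeasurableSpace X := F t
  refine measurable_of_Iic fun c => ?_
  by_cases hc : t ≤ c
  · convert MeasurableSet.univ
    ext x; simp [hc]
  · push Not at hc
    by_cases hc0 : 0 ≤ c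
    · convert hF hc.le _ (hσ c ⟨hc0, hc.le.trans ht.2⟩) using 1
      ext x; simp [hc]
    · convert MeasurableSet.empty
      ext x
      simp only [mem_preimage, mem_Iic, min_le_iff, mem_empty_iff_false, iff_false, not_or]
      exact ⟨by linarith [h0 x], by linarith⟩

lemma sig_meas (m k : ℕ) : ∀ t ∈ Icc 0 T, MeasurableSet[Fraw T t] {ω | sig T hT m k ω ≤ t} := by
  induction k with
  | zero =>
    intro t ht
    simp only [sig, ht.1]
    exact @MeasurableSet.const _ (Fraw T t) _
  | succ k ih =>
    intro t ht
    have hmin : Measurable[Fraw T t] fun ω => min (sig T hT m k ω) t :=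
      min_meas Fraw_mono ht (fun ω => sig_nonneg m k ω) ih
    let ρ : ℝ → Path T → ℝ := fun r ω =>
      min (sig T hT m k ω) t + r * (t - min (sig T hT m k ω) t)
    let Y : ℝ → Path T → ℝ := fun r ω =>
      |ev T hT ω (ρ r ω) - ev T hT ω (min (sig T hT m k ω) t)|
    have hYm : ∀ r ∈ Icc (0:ℝ) 1, Measurable[Fraw T t] (Y r) := by
      intro r hr
      have hρm : Measurable[Fraw T t] (ρ r) := by
        let _ : MeasurableSpace (Path T) := Fraw T t
        exact hmin.add (measurable_const.mul (measurable_const.sub hmin))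
      have h1 : Measurable[Fraw T t] fun ω => ev T hT ω (ρ r ω) :=
        ev_comp_meas ht.1 hρm (fun ω => by
          have : min (sig T hT m k ω) t ≤ t := min_le_right _ _
          simp only [ρ]
          nlinarith [hr.1, hr.2])
      have h2 : Measurable[Fraw T t] fun ω => ev T hT ω (min (sig T hT m k ω) t) :=
        ev_comp_meas ht.1 hmin (fun ω => min_le_right _ _)
      let _ : MeasurableSpace (Path T) := Fraw T t
      exact (h1.sub h2).abs
    have hYc : ∀ ω, Continuous fun r => Y r ω := by
      intro ω
      exact (((ev_cont ω).comp (by fun_prop)).sub continuous_const).abs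
    have e : {ω | sig T hT m (k+1) ω ≤ t} = ⋂ n : ℕ, ⋃ (q : ℚ) (_ : (q:ℝ) ∈ Icc (0:ℝ) 1),
        {ω | (2:ℝ) ^ (-(m:ℤ)) - 1 / ((n:ℝ) + 1) < Y q ω} := by
      ext ω
      have hstep : sig T hT m (k+1) ω ≤ t ↔ ∃ r ∈ Icc (0:ℝ) 1, (2:ℝ) ^ (-(m:ℤ)) ≤ Y r ω := by
        rw [sig_le_iff m k ω ht.2]
        constructor
        · rintro ⟨s, h1, h2, h3⟩
          have hst : sig T hT m k ω ≤ t := h1.trans h2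
          rcases eq_or_lt_of_le hst with h4 | h4
          · have : s = sig T hT m k ω := le_antisymm (h4 ▸ h2) h1
            rw [this] at h3
            have : (0:ℝ) < (2:ℝ) ^ (-(m:ℤ)) := by positivity
            rw [sub_self, abs_zero] at h3
            linarith
          · have hp : 0 < t - sig T hT m k ω := by linarith
            refine ⟨(s - sig T hT m k ω) / (t - sig T hT m k ω),
              ⟨div_nonneg (by linarith) hp.le, (div_le_one hp).2 (by linarith)⟩, ?_⟩
            simp only [Y, ρ, min_eq_left hst]
            rw [div_mul_cancel₀ _ hp.ne', add_sub_cancel]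
            exact h3
        · rintro ⟨r, hr, h⟩
          rcases le_total (sig T hT m k ω) t with hst | hst
          · simp only [Y, ρ, min_eq_left hst] at h
            exact ⟨_, by nlinarith [hr.1, hr.2], by nlinarith [hr.1, hr.2], h⟩
          · simp only [Y, ρ, min_eq_right hst] at h
            have : (0:ℝ) < (2:ℝ) ^ (-(m:ℤ)) := by positivity
            rw [sub_self, mul_zero, add_zero, sub_self, abs_zero] at h
            linarith
      simp only [mem_iInter, mem_iUnion, mem_ofPred_eq, hstep]
      constructor
      · rintro ⟨r, hr, h⟩ n
        have hn : (0:ℝ) < 1 / ((n:ℝ) + 1) := by positivity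
        have hlt : (2:ℝ) ^ (-(m:ℤ)) - 1 / ((n:ℝ) + 1) < Y r ω := by linarith
        have hopen : IsOpen {r | (2:ℝ) ^ (-(m:ℤ)) - 1 / ((n:ℝ) + 1) < Y r ω} :=
          isOpen_lt continuous_const (hYc ω)
        have hcl : r ∈ closure (Ioo (0:ℝ) 1) := by
          rw [closure_Ioo (by norm_num)]; exact hr
        obtain ⟨r', hr1, hr2⟩ := mem_closure_iff.1 hcl _ hopen hlt
        obtain ⟨q, hq1, hq2⟩ := Rat.denseRange_cast.exists_mem_open (hopen.inter isOpen_Ioo)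
          ⟨r', hr1, hr2⟩
        exact ⟨q, ⟨hq2.1.le, hq2.2.le⟩, hq1⟩
      · intro h
        obtain ⟨r, hr, hmax⟩ := isCompact_Icc.exists_isMaxOn (nonempty_Icc.2 zero_le_one)
          (hYc ω).continuousOn
        refine ⟨r, hr, ?_⟩
        by_contra hcon
        push Not at hcon
        obtain ⟨n, hn⟩ := exists_nat_one_div_lt (sub_pos.2 hcon)
        obtain ⟨q, hq, hq2⟩ := h n
        have : Y q ω ≤ Y r ω := hmax hq
        linarith
    rw [e]
    refine @MeasurableSet.iInter _ _ (Fraw T t) _ _ fun n =>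
      @MeasurableSet.iUnion _ _ (Fraw T t) _ _ fun q =>
      @MeasurableSet.iUnion _ _ (Fraw T t) _ _ fun hq => ?_
    exact hYm q hq measurableSet_Ioi

lemma Sm_meas (m : ℕ) {t : ℝ} (ht : t ∈ Icc 0 T) :
    Measurable[Fraw T t] fun ω => Sm T hT m t ω := by
  have hk : ∀ k, Measurable[Fraw T t] fun ω => ev T hT ω (min (sig T hT m k ω) t) := fun k =>
    ev_comp_meas ht.1 (min_meas Fraw_mono ht (fun ω => sig_nonneg m k ω) (sig_meas m k))
      (fun ω => min_le_right _ _)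
  let _ : MeasurableSpace (Path T) := Fraw T t
  refine measurable_of_tendsto_metrizable (f := fun n ω =>
    ∑ k ∈ Finset.range n, ev T hT ω (min (sig T hT m k ω) t) *
    (ev T hT ω (min (sig T hT m (k + 1) ω) t) - ev T hT ω (min (sig T hT m k ω) t))) ?_ ?_
  · intro n
    exact Finset.measurable_fun_sum _ fun k _ => (hk k).mul ((hk (k+1)).sub (hk k))
  · rw [tendsto_pi_nhds]
    intro ω
    obtain ⟨N, hN⟩ := Sm_eq_sum (hT := hT) m ω
    refine tendsto_const_nhds.congr' ?_
    filter_upwards [eventually_ge_atTop N] with n hn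
    exact hN n hn t ht.2

lemma qvRaw_meas {t : ℝ} (ht : t ∈ Icc 0 T) :
    Measurable[Fraw T t] fun ω => qvRaw T hT ω t := by
  have h1 : Measurable[Fraw T t] fun ω => SS T hT t ω :=
    meas_liminf (m := Fraw T t) fun m => Sm_meas m ht
  have h2 : Measurable[Fraw T t] fun ω => ev T hT ω t := ev_meas ht.1 le_rfl
  have h3 : Measurable[Fraw T t] fun ω => ev T hT ω 0 := ev_meas ht.1 ht.1
  let _ : MeasurableSpace (Path T) := Fraw T t
  exact ((h2.pow_const 2).sub (h3.pow_const 2)).sub (measurable_const.mul h1)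

/-- The trace of the raw filtration on `Ω`. -/
abbrev FO (hT : 0 ≤ T) (t : ℝ) : MeasurableSpace (BigOmega T hT) :=
  MeasurableSpace.comap Subtype.val (Fraw T t)

lemma psi_meas (t : ℝ) : Measurable[FO hT t, FbarDelta T hT t]
    fun ω : BigOmega T hT => psiMap T hT ω := by
  rw [measurable_iff_comap_le, FbarDelta, MeasurableSpace.comap_sup, sup_le_iff]
  constructor
  · rw [FbarRaw, MeasurableSpace.comap_iSup]
    refine iSup_le fun s => ?_
    rw [MeasurableSpace.comap_iSup]
    refine iSup_le fun hs => ?_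
    rw [MeasurableSpace.comap_comp, ← measurable_iff_comap_le]
    have hval : Measurable[FO hT t, Fraw T t] (Subtype.val : BigOmega T hT → Path T) :=
      measurable_iff_comap_le.2 le_rfl
    have h1 : Measurable[FO hT t] fun ω : BigOmega T hT => ω.1 s :=
      @Measurable.comp _ _ _ (FO hT t) (Fraw T t) _ _ _ (eval_meas hs) hval
    have h2 : Measurable[FO hT t] fun ω : BigOmega T hT => qv T hT ω.1 s := by
      have h3 : Measurable[Fraw T t] fun ω => qvRaw T hT ω s :=
        (qvRaw_meas s.2).mono (Fraw_mono hs) le_rfl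
      have h4 := @Measurable.comp _ _ _ (FO hT t) (Fraw T t) _ _ _ h3 hval
      convert h4 using 2 with ω
      exact qv_apply ω.2 s
    exact meas_pair (m := FO hT t) h1 h2
  · rw [nullDelta, MeasurableSpace.comap_generateFrom]
    refine MeasurableSpace.generateFrom_le ?_
    rintro _ ⟨N, hN, rfl⟩
    have : (fun ω : BigOmega T hT => psiMap T hT ω) ⁻¹' N = ∅ := by
      ext ω
      simp only [mem_preimage, mem_empty_iff_false, iff_false]
      intro h
      exact hN h ⟨ω, ω.2, rfl⟩
    rw [this]
    exact @MeasurableSet.empty _ (FO hT t)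

lemma FbarDeltaPlus_le {t s : ℝ} (h : t < s) :
    FbarDeltaPlus T hT t ≤ FbarDelta T hT (min s T) := by
  refine sup_le_sup_right ?_ _
  exact iInf_le_of_le s (iInf_le_of_le h le_rfl)

lemma Fplus_iff {t : ℝ} {A : Set (Path T)} :
    MeasurableSet[Fplus T t] A ↔ ∀ s, t < s → MeasurableSet[Fraw T (min s T)] A := by
  rw [Fplus]; simp only [MeasurableSpace.measurableSet_iInf]

end Meas
section Transfer

variable {T : ℝ} {hT : 0 ≤ T}

lemma fst_meas (t : ℝ) : Measurable[FbarRaw T t, Fraw T t] (Prod.fst : PathPair T → Path T) := by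
  rw [measurable_iff_comap_le, Fraw, MeasurableSpace.comap_iSup]
  refine iSup_le fun s => ?_
  rw [MeasurableSpace.comap_iSup]
  refine iSup_le fun hs => ?_
  rw [MeasurableSpace.comap_comp, ← measurable_iff_comap_le]
  have h1 : Measurable[FbarRaw T t] (fun p : PathPair T => (p.1 s, p.2 s)) := by
    rw [measurable_iff_comap_le]
    exact le_iSup_of_le s (le_iSup_of_le hs le_rfl)
  exact measurable_fst.comp h1

lemma fst_plus {t : ℝ} {A : Set (Path T)} (hA : MeasurableSet[Fplus T t] A) :
    MeasurableSet[FbarDeltaPlus T hT t] ((Prod.fst : PathPair T → Path T) ⁻¹' A) := by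
  rw [Fplus_iff] at hA
  have : MeasurableSet[FbarPlus T t] ((Prod.fst : PathPair T → Path T) ⁻¹' A) := by
    rw [FbarPlus]
    simp only [MeasurableSpace.measurableSet_iInf]
    exact fun s hs => fst_meas _ (hA s hs)
  have hle : FbarPlus T t ≤ FbarDeltaPlus T hT t := le_sup_left
  exact hle _ this

lemma mono_nonneg {L : ℕ} {f : Fin (L+1) → ℝ} (h0 : 0 ≤ f 0)
    (hm : ∀ l : Fin L, f l.castSucc ≤ f l.succ) (l : Fin (L+1)) : 0 ≤ f l :=
  h0.trans (Fin.monotone_iff_le_succ.2 hm (Fin.zero_le l))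

lemma mono_le {L : ℕ} {f : Fin (L+1) → ℝ} {T : ℝ} (h0 : f (Fin.last L) ≤ T)
    (hm : ∀ l : Fin L, f l.castSucc ≤ f l.succ) (l : Fin (L+1)) : f l ≤ T :=
  (Fin.monotone_iff_le_succ.2 hm (Fin.le_last l)).trans h0

lemma lift_exists (H : SimpleStrategy T) : ∃ K : SimpleStrategyBar T hT,
    ∀ ω ∈ BigOmega T hT, ∀ t ∈ Icc 0 T,
      integ T H (Sproc T hT) t ω = integBar T hT K (SbarProc T hT) t (psiMap T hT ω) ∧
      integ T H (SS T hT) t ω = integBar T hT K (SSbarProc T hT) t (psiMap T hT ω) := by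
  refine ⟨{ L := H.L
            τ := fun l p => H.τ l p.1
            coeff := fun l p => H.coeff l p.1
            τ_nonneg := fun p => H.τ_nonneg p.1
            τ_mono := fun l p => H.τ_mono l p.1
            τ_le := fun p => H.τ_le p.1
            τ_stop := fun l t ht => fst_plus (SimpleStrategy.τ_stop H l t ht)
            coeff_bdd := fun l => ?_
            coeff_meas := fun l B hB t ht => fst_plus (H.coeff_meas l B hB t ht) }, ?_⟩
  · obtain ⟨C, hC⟩ := H.coeff_bdd l
    exact ⟨C, fun p => hC p.1⟩
  · intro ω hω t ht
    refine ⟨rfl, ?_⟩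
    have hn : ∀ l, min (H.τ l ω) t ∈ Icc 0 T := fun l =>
      ⟨le_min (mono_nonneg (f := fun l => H.τ l ω) (H.τ_nonneg ω) (fun l => H.τ_mono l ω) l) ht.1,
        (min_le_right _ _).trans ht.2⟩
    simp only [integ, integBar]
    refine Finset.sum_congr rfl fun l _ => ?_
    have e1 := SSbar_psi hω (hn l.succ)
    have e2 := SSbar_psi hω (hn l.castSucc)
    rw [← e1, ← e2]
    rfl

lemma FTmono : Monotone fun s => Fraw T (min s T) := fun _ _ h => Fraw_mono (min_le_min_right _ h)

lemma proj_exists (K : SimpleStrategyBar T hT) : ∃ H : SimpleStrategy T,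
    ∀ ω ∈ BigOmega T hT, ∀ t ∈ Icc 0 T,
      integ T H (Sproc T hT) t ω = integBar T hT K (SbarProc T hT) t (psiMap T hT ω) ∧
      integ T H (SS T hT) t ω = integBar T hT K (SSbarProc T hT) t (psiMap T hT ω) := by
  have hpull : ∀ {t s : ℝ} {A : Set (PathPair T)}, t < s → MeasurableSet[FbarDeltaPlus T hT t] A →
      MeasurableSet[MeasurableSpace.comap (Subtype.val : BigOmega T hT → Path T)
        (Fraw T (min s T))] ((fun ω : BigOmega T hT => psiMap T hT ω) ⁻¹' A) :=
    fun hs hA => psi_meas _ (FbarDeltaPlus_le hs _ hA)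
  have hK0 : ∀ l p, 0 ≤ K.τ l p := fun l p =>
    mono_nonneg (f := fun l => K.τ l p) (K.τ_nonneg p) (fun l => K.τ_mono l p) l
  have hK1 : ∀ l p, K.τ l p ≤ T := fun l p =>
    mono_le (f := fun l => K.τ l p) (K.τ_le p) (fun l => K.τ_mono l p) l
  have hst := fun l => ext_stop (O := BigOmega T hT) (FTmono (T := T)) hT
    (fun ω => K.τ l (psiMap T hT ω))
    (fun ω => hK0 l _) (fun ω => hK1 l _) (fun t ht s hs => hpull hs (SimpleStrategyBar.τ_stop K l t ht))
  choose σ hσ0 hσ1 hσm hσe using hst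
  let ρ : Fin (K.L + 1) → Path T → ℝ := fun l ω =>
    (Finset.Iic l).sup' ⟨l, Finset.mem_Iic.2 le_rfl⟩ (fun j => σ j ω)
  have hρle : ∀ l ω c, ρ l ω ≤ c ↔ ∀ j ≤ l, σ j ω ≤ c := by
    intro l ω c
    exact (Finset.sup'_le_iff _ _).trans
      ⟨fun h j hj => h j (Finset.mem_Iic.2 hj), fun h j hj => h j (Finset.mem_Iic.1 hj)⟩
  have hρge : ∀ l ω, σ l ω ≤ ρ l ω := fun l ω => (hρle l ω _).1 le_rfl l le_rfl
  have hρ0 : ∀ l ω, 0 ≤ ρ l ω := fun l ω => (hσ0 l ω).trans (hρge l ω)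
  have hρ1 : ∀ l ω, ρ l ω ≤ T := fun l ω => (hρle l ω T).2 fun j _ => hσ1 j ω
  have hρm : ∀ l, ∀ t ∈ Icc 0 T, ∀ s, t < s → MeasurableSet[Fraw T (min s T)] {ω | ρ l ω ≤ t} := by
    intro l t ht s hs
    have e : {ω | ρ l ω ≤ t} = ⋂ (j) (_ : j ≤ l), {ω | σ j ω ≤ t} := by
      ext ω
      simp only [mem_iInter, mem_ofPred_eq, hρle]
    rw [e]
    exact @MeasurableSet.iInter _ _ (Fraw T (min s T)) _ _ fun j =>
      @MeasurableSet.iInter _ _ (Fraw T (min s T)) _ _ fun _ => hσm j t ht s hs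
  have hρe : ∀ l, ∀ ω : BigOmega T hT, ρ l ω = K.τ l (psiMap T hT ω) := by
    intro l ω
    apply le_antisymm
    · rw [hρle]
      intro j hj
      rw [hσe]
      exact Fin.monotone_iff_le_succ (f := fun l => K.τ l (psiMap T hT ω)) |>.2
        (fun l => K.τ_mono l _) hj
    · rw [← hσe]; exact hρge l ω
  choose C hC using K.coeff_bdd
  have hco := fun l : Fin K.L =>
    ext_coeff (O := BigOmega T hT) (FTmono (T := T)) hT
      (fun ω => K.τ l.castSucc (psiMap T hT ω)) (ρ l.castSucc) (hρ0 _) (hρ1 _) (hρm _) (hρe _)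
      (fun ω => K.coeff l (psiMap T hT ω)) (C l) (fun ω => hC l _)
      (fun B hB t ht s hs => hpull hs (K.coeff_meas l B hB t ht))
  choose c hc1 hc2 hc3 using hco
  refine ⟨{ L := K.L
            τ := ρ
            coeff := c
            τ_nonneg := hρ0 0
            τ_mono := fun l ω => (hρle _ _ _).2 fun j hj =>
              (hρle _ _ _).1 le_rfl j (hj.trans (Fin.castSucc_le_succ l))
            τ_le := hρ1 _
            τ_stop := fun l t ht => Fplus_iff.2 (hρm l t ht)
            coeff_bdd := hc1
            coeff_meas := fun l B hB t ht => Fplus_iff.2 (hc2 l B hB t ht) }, ?_⟩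
  intro ω hω t ht
  have hn : ∀ l, min (K.τ l (psiMap T hT ω)) t ∈ Icc 0 T := fun l =>
      ⟨le_min (hK0 _ _) ht.1, (min_le_right _ _).trans ht.2⟩
  simp only [integ, integBar]
  constructor
  · refine Finset.sum_congr rfl fun l _ => ?_
    rw [hc3 l ⟨ω, hω⟩, hρe _ ⟨ω, hω⟩, hρe _ ⟨ω, hω⟩]
    rfl
  · refine Finset.sum_congr rfl fun l _ => ?_
    rw [hc3 l ⟨ω, hω⟩, hρe _ ⟨ω, hω⟩, hρe _ ⟨ω, hω⟩, SSbar_psi hω (hn l.succ),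
      SSbar_psi hω (hn l.castSucc)]

lemma psiMap_fst (ω : Path T) : (psiMap T hT ω).1 = ω := rfl

lemma PhiSet_eq {Ξ : Set (Path T)} {Xibar : Set (PathPair T)} (hA : AssumptionA T hT Ξ Xibar)
    (ξ : Path T → EReal) :
    PhiSet T hT Ξ ξ = PhiBarSet T hT Xibar (fun p => ξ p.1) := by
  have hTT : T ∈ Icc 0 T := ⟨hT, le_rfl⟩
  have hΞ : ∀ ω, ω ∈ Ξ ↔ ω ∈ BigOmega T hT ∧ psiMap T hT ω ∈ Xibar := by
    intro ω; rw [hA.xi_eq]; rfl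
  ext lam
  constructor
  · rintro ⟨H, G, h1, h2⟩
    choose H' hH' using fun n => lift_exists (hT := hT) (H n)
    choose G' hG' using fun n => lift_exists (hT := hT) (G n)
    refine ⟨H', G', ?_, ?_⟩
    · rintro n t ht _ ⟨⟨ω, hω, rfl⟩, hx⟩
      rw [← (hH' n ω hω t ht).1, ← (hG' n ω hω t ht).2]
      exact h1 n t ht ω ((hΞ ω).2 ⟨hω, hx⟩)
    · rintro _ ⟨⟨ω, hω, rfl⟩, hx⟩
      have := h2 ω ((hΞ ω).2 ⟨hω, hx⟩)
      simpa only [psiMap_fst, (hH' _ ω hω T hTT).1, (hG' _ ω hω T hTT).2] using this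
  · rintro ⟨H, G, h1, h2⟩
    choose H' hH' using fun n => proj_exists (H n)
    choose G' hG' using fun n => proj_exists (G n)
    refine ⟨H', G', ?_, ?_⟩
    · intro n t ht ω hx
      obtain ⟨hω, hx⟩ := (hΞ ω).1 hx
      rw [(hH' n ω hω t ht).1, (hG' n ω hω t ht).2]
      exact h1 n t ht _ ⟨⟨ω, hω, rfl⟩, hx⟩
    · intro ω hx
      obtain ⟨hω, hx⟩ := (hΞ ω).1 hx
      have := h2 _ ⟨⟨ω, hω, rfl⟩, hx⟩
      simpa only [psiMap_fst, (hH' _ ω hω T hTT).1, (hG' _ ω hω T hTT).2] using this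

end Transfer

/-- **Lemma 4.6 (primal transition).** Under Assumption A, for every function
`ξ : C[0,T] → (-∞,∞]`, the superhedging price on the original space coincides with the
superhedging price on the enlarged space applied to `ξ ∘ S̄`. -/
theorem primal_transfer (T : ℝ) (hT : 0 ≤ T)
    (Ξ : Set (Path T)) (Xibar : Set (PathPair T)) (hA : AssumptionA T hT Ξ Xibar)
    (ξ : Path T → EReal) (hξ : ∀ ω, ξ ω ≠ ⊥) :
    Phi T hT Ξ ξ = PhiBar T hT Xibar (fun p => ξ p.1) := by
  rw [Phi, PhiBar, PhiSet_eq hA ξ]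

end PathwiseSuperhedging
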